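/- (Block monotone Gauss–Seidel method.) Assume the quasimonotone assumptions hold for ordered upper and lower solutions Ũ, Û of the nonlinear difference scheme. Let {Ū⁽ⁿ⁾} and {U̲⁽ⁿ⁾} be sequences of mesh vector functions generated by the block Gauss–Seidel iteration with Ū⁽⁰⁾ = Ũ and U̲⁽⁰⁾ = Û. Then for all n ≥ 1 and all mesh points, U̲_α⁽ⁿ⁻¹⁾ ≤ U̲_α⁽ⁿ⁾ ≤ Ū_α⁽ⁿ⁾ ≤ Ū_α⁽ⁿ⁻¹⁾ for α = 1,2; the pointwise limits Ū_α = lim_{n→∞} Ū_α⁽ⁿ⁾ and U̲_α = lim_{n→∞} U̲_α⁽ⁿ⁾ exist; Ū = (Ū₁,Ū₂) and U̲ = (U̲₁,U̲₂) are solutions of the nonlinear difference scheme with U̲ ≤ Ū; and every solution S = (S₁,S₂) of the nonlinear difference scheme lying in the sector ⟨Û,Ũ⟩ satisfies U̲_α ≤ S_α ≤ Ū_α at every mesh point for α = 1,2. -/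

import Mathlib

namespace BlockMonotone

/-- A rectangular mesh on the unit square with `Nx, Ny ≥ 2` subdivisions. -/
structure Mesh where
  Nx : ℕ
  Ny : ℕ
  hNx : 2 ≤ Nx
  hNy : 2 ≤ Ny

namespace Mesh

variable (M : Mesh)

/-- Mesh spacing in the x-direction. -/
noncomputable def hx : ℝ := 1 / (M.Nx : ℝ)

/-- Mesh spacing in the y-direction. -/
noncomputable def hy : ℝ := 1 / (M.Ny : ℝ)

/-- `(i,j)` is a mesh point. -/
def IsMeshPt (i j : ℕ) : Prop := i ≤ M.Nx ∧ j ≤ M.Ny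

/-- `(i,j)` is an interior mesh point. -/
def IsInterior (i j : ℕ) : Prop := 1 ≤ i ∧ i ≤ M.Nx - 1 ∧ 1 ≤ j ∧ j ≤ M.Ny - 1

/-- `(i,j)` is a boundary mesh point. -/
def IsBoundary (i j : ℕ) : Prop := M.IsMeshPt i j ∧ ¬ M.IsInterior i j

/-- Coefficient `l_α(i,j) = ε/hx² + v(i,j)/hx`. -/
noncomputable def lC (ε : ℝ) (v : ℕ → ℕ → ℝ) (i j : ℕ) : ℝ := ε / M.hx ^ 2 + v i j / M.hx

/-- Coefficient `r_α(i,j) = ε/hx²`. -/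
noncomputable def rC (ε : ℝ) : ℝ := ε / M.hx ^ 2

/-- Coefficient `b_α(i,j) = ε/hy² + v(i,j)/hy`. -/
noncomputable def bC (ε : ℝ) (v : ℕ → ℕ → ℝ) (i j : ℕ) : ℝ := ε / M.hy ^ 2 + v i j / M.hy

/-- Coefficient `t_α(i,j) = ε/hy²`. -/
noncomputable def tC (ε : ℝ) : ℝ := ε / M.hy ^ 2

/-- Coefficient `d_α(i,j) = l + r + b + t`. -/
noncomputable def dC (ε : ℝ) (v : ℕ → ℕ → ℝ) (i j : ℕ) : ℝ :=
  M.lC ε v i j + M.rC ε + M.bC ε v i j + M.tC ε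

/-- The discrete operator `𝓛 U(i,j)` at interior points. -/
noncomputable def discL (ε : ℝ) (v : ℕ → ℕ → ℝ) (U : ℕ → ℕ → ℝ) (i j : ℕ) : ℝ :=
  M.dC ε v i j * U i j - M.lC ε v i j * U (i - 1) j - M.rC ε * U (i + 1) j
    - M.bC ε v i j * U i (j - 1) - M.tC ε * U i (j + 1)

end Mesh

/-- Partial derivative of a two-variable real function in its first variable. -/
noncomputable def p1 (f : ℝ → ℝ → ℝ) (u₁ u₂ : ℝ) : ℝ := deriv (fun x => f x u₂) u₁

/-- Partial derivative of a two-variable real function in its second variable. -/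
noncomputable def p2 (f : ℝ → ℝ → ℝ) (u₁ u₂ : ℝ) : ℝ := deriv (fun y => f u₁ y) u₂

end BlockMonotone

open BlockMonotone

namespace BlockMonotone

/-- Pointwise order of vector functions on the mesh. -/
def MeshLE (M : Mesh) (X Y : Fin 2 → ℕ → ℕ → ℝ) : Prop :=
  ∀ a i j, M.IsMeshPt i j → X a i j ≤ Y a i j

/-- The implicit part of the block Gauss–Seidel iteration. -/
noncomputable def lineOp (M : Mesh) (ε : ℝ) (v c U : ℕ → ℕ → ℝ) (i j : ℕ) : ℝ :=
  M.dC ε v i j * U i j - M.bC ε v i j * U i (j - 1) - M.tC ε * U i (j + 1)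
    - M.lC ε v i j * U (i - 1) j + c i j * U i j

/-- The explicit part of the block Gauss–Seidel iteration. -/
noncomputable def explicitPart (M : Mesh) (ε : Fin 2 → ℝ) (c : Fin 2 → ℕ → ℕ → ℝ)
    (f : Fin 2 → ℕ → ℕ → ℝ → ℝ → ℝ) (X : Fin 2 → ℕ → ℕ → ℝ) (a : Fin 2) (i j : ℕ) : ℝ :=
  M.rC (ε a) * X a (i + 1) j + c a i j * X a i j - f a i j (X 0 i j) (X 1 i j)

/-- `Y` lies below the block Gauss–Seidel iterate of `X`, in the sense of inequalities. -/
def IsSubstep (M : Mesh) (ε : Fin 2 → ℝ) (v c : Fin 2 → ℕ → ℕ → ℝ)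
    (f : Fin 2 → ℕ → ℕ → ℝ → ℝ → ℝ) (g X Y : Fin 2 → ℕ → ℕ → ℝ) : Prop :=
  (∀ a i j, M.IsInterior i j →
    lineOp M (ε a) (v a) (c a) (Y a) i j ≤ explicitPart M ε c f X a i j) ∧
  ∀ a i j, M.IsBoundary i j → Y a i j ≤ g a i j

/-- `Y` lies above the block Gauss–Seidel iterate of `X`, in the sense of inequalities. -/
def IsSuperstep (M : Mesh) (ε : Fin 2 → ℝ) (v c : Fin 2 → ℕ → ℕ → ℝ)
    (f : Fin 2 → ℕ → ℕ → ℝ → ℝ → ℝ) (g X Y : Fin 2 → ℕ → ℕ → ℝ) : Prop :=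
  (∀ a i j, M.IsInterior i j →
    explicitPart M ε c f X a i j ≤ lineOp M (ε a) (v a) (c a) (Y a) i j) ∧
  ∀ a i j, M.IsBoundary i j → g a i j ≤ Y a i j

theorem MeshLE.refl (M : Mesh) (X : Fin 2 → ℕ → ℕ → ℝ) : MeshLE M X X :=
  fun _ _ _ _ => le_rfl

namespace Mesh

variable {M : Mesh} {i j : ℕ}

theorem hx_pos (M : Mesh) : 0 < M.hx := by
  have : (0 : ℝ) < M.Nx := by exact_mod_cast (by have := M.hNx; omega : 0 < M.Nx)
  unfold hx; positivity

theorem hy_pos (M : Mesh) : 0 < M.hy := by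
  have : (0 : ℝ) < M.Ny := by exact_mod_cast (by have := M.hNy; omega : 0 < M.Ny)
  unfold hy; positivity

theorem IsInterior.isMeshPt (h : M.IsInterior i j) : M.IsMeshPt i j := by
  unfold IsInterior at h; unfold IsMeshPt; omega

theorem IsInterior.isMeshPt_right (h : M.IsInterior i j) : M.IsMeshPt (i + 1) j := by
  unfold IsInterior at h; unfold IsMeshPt; omega

theorem IsInterior.isMeshPt_left (h : M.IsInterior i j) : M.IsMeshPt (i - 1) j := by
  unfold IsInterior at h; unfold IsMeshPt; omega

theorem IsInterior.isMeshPt_top (h : M.IsInterior i j) : M.IsMeshPt i (j + 1) := by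
  unfold IsInterior at h; unfold IsMeshPt; omega

theorem IsInterior.isMeshPt_bottom (h : M.IsInterior i j) : M.IsMeshPt i (j - 1) := by
  unfold IsInterior at h; unfold IsMeshPt; omega

theorem rC_pos (M : Mesh) {ε : ℝ} (hε : 0 < ε) : 0 < M.rC ε := by
  have := M.hx_pos; unfold rC; positivity

theorem tC_pos (M : Mesh) {ε : ℝ} (hε : 0 < ε) : 0 < M.tC ε := by
  have := M.hy_pos; unfold tC; positivity

theorem lC_pos (M : Mesh) {ε : ℝ} (hε : 0 < ε) {v : ℕ → ℕ → ℝ} (hv : 0 ≤ v i j) :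
    0 < M.lC ε v i j := by
  have := M.hx_pos; unfold lC; positivity

theorem bC_pos (M : Mesh) {ε : ℝ} (hε : 0 < ε) {v : ℕ → ℕ → ℝ} (hv : 0 ≤ v i j) :
    0 < M.bC ε v i j := by
  have := M.hy_pos; unfold bC; positivity

end Mesh

section Comparison

variable {M : Mesh}

/-- Discrete maximum principle for the implicit part of the iteration. -/
theorem nonneg_of_lineOp_nonneg {ε : ℝ} (hε : 0 < ε) {v c W : ℕ → ℕ → ℝ}
    (hv : ∀ i j, M.IsMeshPt i j → 0 ≤ v i j) (hc : ∀ i j, M.IsMeshPt i j → 0 ≤ c i j)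
    (hint : ∀ i j, M.IsInterior i j → 0 ≤ lineOp M ε v c W i j)
    (hbd : ∀ i j, M.IsBoundary i j → 0 ≤ W i j) :
    ∀ i j, M.IsMeshPt i j → 0 ≤ W i j := by
  obtain ⟨⟨p, q⟩, hpq, hmin⟩ :=
    (Finset.range (M.Nx + 1) ×ˢ Finset.range (M.Ny + 1)).exists_min_image
      (fun p => W p.1 p.2) ⟨(0, 0), by simp⟩
  have hp : M.IsMeshPt p q := by
    simp only [Finset.mem_product, Finset.mem_range] at hpq
    unfold Mesh.IsMeshPt; omega
  have hle : ∀ i j, M.IsMeshPt i j → W p q ≤ W i j := fun i j h => by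
    refine hmin (i, j) ?_
    unfold Mesh.IsMeshPt at h
    simp only [Finset.mem_product, Finset.mem_range]
    omega
  suffices h : 0 ≤ W p q from fun i j hij => h.trans (hle i j hij)
  by_cases hI : M.IsInterior p q
  · by_contra! hneg
    have h := hint p q hI
    have hl := mul_le_mul_of_nonneg_left (hle _ _ hI.isMeshPt_left) (M.lC_pos hε (hv p q hp)).le
    have hb := mul_le_mul_of_nonneg_left (hle _ _ hI.isMeshPt_bottom) (M.bC_pos hε (hv p q hp)).le
    have ht := mul_le_mul_of_nonneg_left (hle _ _ hI.isMeshPt_top) (M.tC_pos hε).le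
    have hr := mul_neg_of_pos_of_neg (M.rC_pos hε) hneg
    have hcW := mul_nonpos_of_nonneg_of_nonpos (hc p q hp) hneg.le
    unfold lineOp Mesh.dC at h
    linarith
  · exact hbd p q ⟨hp, hI⟩

variable {ε : Fin 2 → ℝ} {v c : Fin 2 → ℕ → ℕ → ℝ} {f : Fin 2 → ℕ → ℕ → ℝ → ℝ → ℝ}
  {g : Fin 2 → ℕ → ℕ → ℝ}

theorem IsSubstep.meshLE (hε : ∀ a, 0 < ε a) (hv : ∀ a i j, M.IsMeshPt i j → 0 ≤ v a i j)
    (hc : ∀ a i j, M.IsMeshPt i j → 0 ≤ c a i j) {X X' Y Y' : Fin 2 → ℕ → ℕ → ℝ}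
    (hY : IsSubstep M ε v c f g X Y) (hY' : IsSuperstep M ε v c f g X' Y')
    (hXX' : ∀ a i j, M.IsInterior i j →
      explicitPart M ε c f X a i j ≤ explicitPart M ε c f X' a i j) :
    MeshLE M Y Y' := by
  intro a i j hij
  refine sub_nonneg.1 (nonneg_of_lineOp_nonneg (W := fun i j => Y' a i j - Y a i j) (hε a) (hv a)
    (hc a) (fun i j h => ?_) (fun i j h => ?_) i j hij)
  · have h1 := hY.1 a i j h
    have h2 := hY'.1 a i j h
    have h3 := hXX' a i j h
    unfold lineOp at *
    linarith
  · exact sub_nonneg.2 ((hY.2 a i j h).trans (hY'.2 a i j h))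

/-- A vector function solves the scheme at a point iff it is a fixed point of the iteration. -/
theorem lineOp_sub_explicitPart (U : Fin 2 → ℕ → ℕ → ℝ) (a : Fin 2) (i j : ℕ) :
    lineOp M (ε a) (v a) (c a) (U a) i j - explicitPart M ε c f U a i j =
      M.discL (ε a) (v a) (U a) i j + f a i j (U 0 i j) (U 1 i j) := by
  unfold lineOp explicitPart Mesh.discL
  ring

end Comparison

theorem sub_le_mul_sub_of_deriv_le {h : ℝ → ℝ} (hd : Differentiable ℝ h) {x y k : ℝ}
    (hk : ∀ z, x ≤ z → z ≤ y → deriv h z ≤ k) (hxy : x ≤ y) : h y - h x ≤ k * (y - x) :=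
  (convex_Icc x y).image_sub_le_mul_sub_of_deriv_le hd.continuous.continuousOn
    hd.differentiableOn
    (fun z hz => hk z (interior_subset hz).1 (interior_subset hz).2) x
    (Set.left_mem_Icc.2 hxy) y (Set.right_mem_Icc.2 hxy) hxy

/-- Increment bound for a function of two variables whose partial derivatives are bounded above
on a rectangle. -/
theorem sub_le_add_of_partial_le {F : ℝ → ℝ → ℝ} (hF : ContDiff ℝ 1 fun p : ℝ × ℝ => F p.1 p.2)
    {x₁ x₂ y₁ y₂ k₁ k₂ : ℝ} (h₁ : x₁ ≤ y₁) (h₂ : x₂ ≤ y₂)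
    (hk₁ : ∀ u₁ u₂, x₁ ≤ u₁ → u₁ ≤ y₁ → x₂ ≤ u₂ → u₂ ≤ y₂ → p1 F u₁ u₂ ≤ k₁)
    (hk₂ : ∀ u₁ u₂, x₁ ≤ u₁ → u₁ ≤ y₁ → x₂ ≤ u₂ → u₂ ≤ y₂ → p2 F u₁ u₂ ≤ k₂) :
    F y₁ y₂ - F x₁ x₂ ≤ k₁ * (y₁ - x₁) + k₂ * (y₂ - x₂) := by
  have hd := hF.differentiable one_ne_zero
  have d₁ : Differentiable ℝ fun x => F x y₂ :=
    hd.comp (differentiable_id.prodMk (differentiable_const y₂))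
  have d₂ : Differentiable ℝ fun y => F x₁ y :=
    hd.comp ((differentiable_const x₁).prodMk differentiable_id)
  have e₁ := sub_le_mul_sub_of_deriv_le d₁ (fun z hz hz' => hk₁ z y₂ hz hz' h₂ le_rfl) h₁
  have e₂ := sub_le_mul_sub_of_deriv_le d₂ (fun z hz hz' => hk₂ x₁ z le_rfl h₁ hz hz') h₂
  linarith

/-- Under the quasimonotone assumptions the explicit part is monotone on the sector. -/
theorem explicitPart_mono {M : Mesh} {ε : Fin 2 → ℝ} (hε : ∀ a, 0 < ε a)
    {c : Fin 2 → ℕ → ℕ → ℝ} {f : Fin 2 → ℕ → ℕ → ℝ → ℝ → ℝ} {Utilde Uhat : Fin 2 → ℕ → ℕ → ℝ}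
    (hf : ∀ a i j, ContDiff ℝ 1 (fun p : ℝ × ℝ => f a i j p.1 p.2))
    (hq1 : ∀ i j, M.IsMeshPt i j → ∀ u₁ u₂,
      Uhat 0 i j ≤ u₁ → u₁ ≤ Utilde 0 i j → Uhat 1 i j ≤ u₂ → u₂ ≤ Utilde 1 i j →
      p1 (f 0 i j) u₁ u₂ ≤ c 0 i j ∧ p2 (f 1 i j) u₁ u₂ ≤ c 1 i j)
    (hq2 : ∀ i j, M.IsMeshPt i j → ∀ u₁ u₂,
      Uhat 0 i j ≤ u₁ → u₁ ≤ Utilde 0 i j → Uhat 1 i j ≤ u₂ → u₂ ≤ Utilde 1 i j →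
      p2 (f 0 i j) u₁ u₂ ≤ 0 ∧ p1 (f 1 i j) u₁ u₂ ≤ 0)
    {X Y : Fin 2 → ℕ → ℕ → ℝ} (hX : MeshLE M Uhat X) (hXY : MeshLE M X Y)
    (hY : MeshLE M Y Utilde) (a : Fin 2) (i j : ℕ) (hij : M.IsInterior i j) :
    explicitPart M ε c f X a i j ≤ explicitPart M ε c f Y a i j := by
  have hp := hij.isMeshPt
  have hr := mul_le_mul_of_nonneg_left (hXY a _ _ hij.isMeshPt_right) (M.rC_pos (hε a)).le
  have hsec : ∀ u₁ u₂, X 0 i j ≤ u₁ → u₁ ≤ Y 0 i j → X 1 i j ≤ u₂ → u₂ ≤ Y 1 i j →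
      (p1 (f 0 i j) u₁ u₂ ≤ c 0 i j ∧ p2 (f 1 i j) u₁ u₂ ≤ c 1 i j) ∧
      (p2 (f 0 i j) u₁ u₂ ≤ 0 ∧ p1 (f 1 i j) u₁ u₂ ≤ 0) := fun u₁ u₂ h1 h2 h3 h4 => by
    have h1' := (hX 0 i j hp).trans h1
    have h2' := h2.trans (hY 0 i j hp)
    have h3' := (hX 1 i j hp).trans h3
    have h4' := h4.trans (hY 1 i j hp)
    exact ⟨hq1 i j hp u₁ u₂ h1' h2' h3' h4', hq2 i j hp u₁ u₂ h1' h2' h3' h4'⟩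
  unfold explicitPart
  match a with
  | 0 =>
    have := sub_le_add_of_partial_le (hf 0 i j) (hXY 0 i j hp) (hXY 1 i j hp)
      (fun u₁ u₂ h1 h2 h3 h4 => (hsec u₁ u₂ h1 h2 h3 h4).1.1)
      (fun u₁ u₂ h1 h2 h3 h4 => (hsec u₁ u₂ h1 h2 h3 h4).2.1)
    linarith
  | 1 =>
    have := sub_le_add_of_partial_le (hf 1 i j) (hXY 0 i j hp) (hXY 1 i j hp)
      (fun u₁ u₂ h1 h2 h3 h4 => (hsec u₁ u₂ h1 h2 h3 h4).2.2)
      (fun u₁ u₂ h1 h2 h3 h4 => (hsec u₁ u₂ h1 h2 h3 h4).1.2)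
    linarith

open Filter Topology in
/-- A pointwise limit of block Gauss–Seidel iterates solves the nonlinear scheme. -/
theorem solution_of_tendsto {M : Mesh} {ε : Fin 2 → ℝ} {v c : Fin 2 → ℕ → ℕ → ℝ}
    {f : Fin 2 → ℕ → ℕ → ℝ → ℝ → ℝ} {g : Fin 2 → ℕ → ℕ → ℝ}
    (hf : ∀ a i j, Continuous (fun p : ℝ × ℝ => f a i j p.1 p.2))
    {U : ℕ → Fin 2 → ℕ → ℕ → ℝ} {L : Fin 2 → ℕ → ℕ → ℝ}
    (hsub : ∀ n, IsSubstep M ε v c f g (U n) (U (n + 1)))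
    (hsuper : ∀ n, IsSuperstep M ε v c f g (U n) (U (n + 1)))
    (hL : ∀ a i j, M.IsMeshPt i j → Tendsto (fun n => U n a i j) atTop (𝓝 (L a i j))) :
    (∀ a i j, M.IsInterior i j →
      M.discL (ε a) (v a) (L a) i j + f a i j (L 0 i j) (L 1 i j) = 0) ∧
    ∀ a i j, M.IsBoundary i j → L a i j = g a i j := by
  have hL' : ∀ a i j, M.IsMeshPt i j →
      Tendsto (fun n => U (n + 1) a i j) atTop (𝓝 (L a i j)) :=
    fun a i j h => (tendsto_add_atTop_iff_nat 1).2 (hL a i j h)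
  refine ⟨fun a i j h => ?_, fun a i j h => ?_⟩
  · rw [← lineOp_sub_explicitPart (c := c), sub_eq_zero]
    have hlhs : Tendsto (fun n => lineOp M (ε a) (v a) (c a) (U (n + 1) a) i j) atTop
        (𝓝 (lineOp M (ε a) (v a) (c a) (L a) i j)) :=
      (((((hL' a _ _ h.isMeshPt).const_mul _).sub ((hL' a _ _ h.isMeshPt_bottom).const_mul _)).sub
        ((hL' a _ _ h.isMeshPt_top).const_mul _)).sub
        ((hL' a _ _ h.isMeshPt_left).const_mul _)).add ((hL' a _ _ h.isMeshPt).const_mul _)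
    have hfL : Tendsto (fun n => f a i j (U n 0 i j) (U n 1 i j)) atTop
        (𝓝 (f a i j (L 0 i j) (L 1 i j))) :=
      ((hf a i j).tendsto (L 0 i j, L 1 i j)).comp
        ((hL 0 _ _ h.isMeshPt).prodMk_nhds (hL 1 _ _ h.isMeshPt))
    have hrhs : Tendsto (fun n => explicitPart M ε c f (U n) a i j) atTop
        (𝓝 (explicitPart M ε c f L a i j)) :=
      (((hL a _ _ h.isMeshPt_right).const_mul _).add ((hL a _ _ h.isMeshPt).const_mul _)).sub hfL
    refine tendsto_nhds_unique hlhs (hrhs.congr fun n => ?_)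
    exact le_antisymm ((hsuper n).1 a i j h) ((hsub n).1 a i j h)
  · refine tendsto_nhds_unique (hL' a i j h.1) (tendsto_const_nhds.congr fun n => ?_)
    exact le_antisymm ((hsuper n).2 a i j h) ((hsub n).2 a i j h)

end BlockMonotone

/-- Block monotone Gauss–Seidel method: monotone convergence of the upper and lower
sequences to maximal and minimal solutions of the nonlinear difference scheme. -/
theorem block_monotone_gauss_seidel (M : Mesh)
    (ε : Fin 2 → ℝ) (hε : ∀ a, 0 < ε a)
    (v : Fin 2 → ℕ → ℕ → ℝ) (hv : ∀ a i j, M.IsMeshPt i j → 0 ≤ v a i j)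
    (f : Fin 2 → ℕ → ℕ → ℝ → ℝ → ℝ) (g : Fin 2 → ℕ → ℕ → ℝ)
    (Utilde Uhat : Fin 2 → ℕ → ℕ → ℝ)
    (c : Fin 2 → ℕ → ℕ → ℝ)
    (hc : ∀ a i j, M.IsMeshPt i j → 0 ≤ c a i j)
    (hf : ∀ a i j, ContDiff ℝ 1 (fun p : ℝ × ℝ => f a i j p.1 p.2))
    (hq1 : ∀ i j, M.IsMeshPt i j → ∀ u₁ u₂,
      Uhat 0 i j ≤ u₁ → u₁ ≤ Utilde 0 i j → Uhat 1 i j ≤ u₂ → u₂ ≤ Utilde 1 i j →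
      p1 (f 0 i j) u₁ u₂ ≤ c 0 i j ∧ p2 (f 1 i j) u₁ u₂ ≤ c 1 i j)
    (hq2 : ∀ i j, M.IsMeshPt i j → ∀ u₁ u₂,
      Uhat 0 i j ≤ u₁ → u₁ ≤ Utilde 0 i j → Uhat 1 i j ≤ u₂ → u₂ ≤ Utilde 1 i j →
      p2 (f 0 i j) u₁ u₂ ≤ 0 ∧ p1 (f 1 i j) u₁ u₂ ≤ 0)
    (hord : ∀ a i j, M.IsMeshPt i j → Uhat a i j ≤ Utilde a i j)
    (hupper : ∀ a i j, M.IsInterior i j →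
      0 ≤ M.discL (ε a) (v a) (Utilde a) i j + f a i j (Utilde 0 i j) (Utilde 1 i j))
    (hlower : ∀ a i j, M.IsInterior i j →
      M.discL (ε a) (v a) (Uhat a) i j + f a i j (Uhat 0 i j) (Uhat 1 i j) ≤ 0)
    (hbd : ∀ a i j, M.IsBoundary i j → Uhat a i j ≤ g a i j ∧ g a i j ≤ Utilde a i j)
    (Ub Ul : ℕ → Fin 2 → ℕ → ℕ → ℝ)
    (hUb0 : ∀ a i j, Ub 0 a i j = Utilde a i j)
    (hUl0 : ∀ a i j, Ul 0 a i j = Uhat a i j)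
    (hubstep : ∀ n, 1 ≤ n → ∀ a i j, M.IsInterior i j →
      M.dC (ε a) (v a) i j * Ub n a i j - M.bC (ε a) (v a) i j * Ub n a i (j - 1)
          - M.tC (ε a) * Ub n a i (j + 1) - M.lC (ε a) (v a) i j * Ub n a (i - 1) j
          + c a i j * Ub n a i j
        = M.rC (ε a) * Ub (n - 1) a (i + 1) j + c a i j * Ub (n - 1) a i j
          - f a i j (Ub (n - 1) 0 i j) (Ub (n - 1) 1 i j))
    (hubbd : ∀ n, 1 ≤ n → ∀ a i j, M.IsBoundary i j → Ub n a i j = g a i j)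
    (hlostep : ∀ n, 1 ≤ n → ∀ a i j, M.IsInterior i j →
      M.dC (ε a) (v a) i j * Ul n a i j - M.bC (ε a) (v a) i j * Ul n a i (j - 1)
          - M.tC (ε a) * Ul n a i (j + 1) - M.lC (ε a) (v a) i j * Ul n a (i - 1) j
          + c a i j * Ul n a i j
        = M.rC (ε a) * Ul (n - 1) a (i + 1) j + c a i j * Ul (n - 1) a i j
          - f a i j (Ul (n - 1) 0 i j) (Ul (n - 1) 1 i j))
    (hlobd : ∀ n, 1 ≤ n → ∀ a i j, M.IsBoundary i j → Ul n a i j = g a i j) :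
    (∀ n, 1 ≤ n → ∀ a i j, M.IsMeshPt i j →
      Ul (n - 1) a i j ≤ Ul n a i j ∧ Ul n a i j ≤ Ub n a i j
        ∧ Ub n a i j ≤ Ub (n - 1) a i j)
    ∧ ∃ Ubar Ulow : Fin 2 → ℕ → ℕ → ℝ,
      (∀ a i j, M.IsMeshPt i j →
        Filter.Tendsto (fun n => Ub n a i j) Filter.atTop (nhds (Ubar a i j)))
      ∧ (∀ a i j, M.IsMeshPt i j →
        Filter.Tendsto (fun n => Ul n a i j) Filter.atTop (nhds (Ulow a i j)))
      ∧ (∀ a i j, M.IsInterior i j →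
        M.discL (ε a) (v a) (Ubar a) i j + f a i j (Ubar 0 i j) (Ubar 1 i j) = 0)
      ∧ (∀ a i j, M.IsBoundary i j → Ubar a i j = g a i j)
      ∧ (∀ a i j, M.IsInterior i j →
        M.discL (ε a) (v a) (Ulow a) i j + f a i j (Ulow 0 i j) (Ulow 1 i j) = 0)
      ∧ (∀ a i j, M.IsBoundary i j → Ulow a i j = g a i j)
      ∧ (∀ a i j, M.IsMeshPt i j → Ulow a i j ≤ Ubar a i j)
      ∧ (∀ S : Fin 2 → ℕ → ℕ → ℝ,
          (∀ a i j, M.IsInterior i j →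
            M.discL (ε a) (v a) (S a) i j + f a i j (S 0 i j) (S 1 i j) = 0) →
          (∀ a i j, M.IsBoundary i j → S a i j = g a i j) →
          (∀ a i j, M.IsMeshPt i j → Uhat a i j ≤ S a i j ∧ S a i j ≤ Utilde a i j) →
          ∀ a i j, M.IsMeshPt i j → Ulow a i j ≤ S a i j ∧ S a i j ≤ Ubar a i j) := by
  have mono : ∀ X Y, MeshLE M Uhat X → MeshLE M X Y → MeshLE M Y Utilde → ∀ a i j,
      M.IsInterior i j → explicitPart M ε c f X a i j ≤ explicitPart M ε c f Y a i j :=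
    fun X Y => explicitPart_mono hε hf hq1 hq2
  have step : ∀ X X' Y Y', MeshLE M Uhat X → MeshLE M X X' → MeshLE M X' Utilde →
      IsSubstep M ε v c f g X Y → IsSuperstep M ε v c f g X' Y' → MeshLE M Y Y' :=
    fun X X' Y Y' h1 h2 h3 hY hY' => hY.meshLE hε hv hc hY' (mono X X' h1 h2 h3)
  have hUb0' : Ub 0 = Utilde := by ext a i j; exact hUb0 a i j
  have hUl0' : Ul 0 = Uhat := by ext a i j; exact hUl0 a i j
  have superTilde : IsSuperstep M ε v c f g Utilde Utilde :=
    ⟨fun a i j h => sub_nonneg.1 (by rw [lineOp_sub_explicitPart]; exact hupper a i j h),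
      fun a i j h => (hbd a i j h).2⟩
  have subHat : IsSubstep M ε v c f g Uhat Uhat :=
    ⟨fun a i j h => sub_nonpos.1 (by rw [lineOp_sub_explicitPart]; exact hlower a i j h),
      fun a i j h => (hbd a i j h).1⟩
  have subUb : ∀ n, IsSubstep M ε v c f g (Ub n) (Ub (n + 1)) := fun n =>
    ⟨fun a i j h => (hubstep (n + 1) n.succ_pos a i j h).le,
      fun a i j h => (hubbd (n + 1) n.succ_pos a i j h).le⟩
  have superUb : ∀ n, IsSuperstep M ε v c f g (Ub n) (Ub (n + 1)) := fun n =>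
    ⟨fun a i j h => (hubstep (n + 1) n.succ_pos a i j h).ge,
      fun a i j h => (hubbd (n + 1) n.succ_pos a i j h).ge⟩
  have subUl : ∀ n, IsSubstep M ε v c f g (Ul n) (Ul (n + 1)) := fun n =>
    ⟨fun a i j h => (hlostep (n + 1) n.succ_pos a i j h).le,
      fun a i j h => (hlobd (n + 1) n.succ_pos a i j h).le⟩
  have superUl : ∀ n, IsSuperstep M ε v c f g (Ul n) (Ul (n + 1)) := fun n =>
    ⟨fun a i j h => (hlostep (n + 1) n.succ_pos a i j h).ge,
      fun a i j h => (hlobd (n + 1) n.succ_pos a i j h).ge⟩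
  have sector : ∀ U : ℕ → Fin 2 → ℕ → ℕ → ℝ, MeshLE M Uhat (U 0) → MeshLE M (U 0) Utilde →
      (∀ n, IsSubstep M ε v c f g (U n) (U (n + 1))) →
      (∀ n, IsSuperstep M ε v c f g (U n) (U (n + 1))) →
      ∀ n, MeshLE M Uhat (U n) ∧ MeshLE M (U n) Utilde := by
    intro U h0 h0' hsub hsuper n
    induction n with
    | zero => exact ⟨h0, h0'⟩
    | succ n ih =>
      exact ⟨step _ _ _ _ (.refl M _) ih.1 ih.2 subHat (hsuper n),
        step _ _ _ _ ih.1 ih.2 (.refl M _) (hsub n) superTilde⟩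
  have secUb := sector Ub (hUb0' ▸ hord) (hUb0' ▸ .refl M _) subUb superUb
  have secUl := sector Ul (hUl0' ▸ .refl M _) (hUl0' ▸ hord) subUl superUl
  have antiUb : ∀ n, MeshLE M (Ub (n + 1)) (Ub n) := by
    intro n
    induction n with
    | zero => rw [hUb0']; exact (secUb 1).2
    | succ n ih => exact step _ _ _ _ (secUb (n + 1)).1 ih (secUb n).2 (subUb (n + 1)) (superUb n)
  have monoUl : ∀ n, MeshLE M (Ul n) (Ul (n + 1)) := by
    intro n
    induction n with
    | zero => rw [hUl0']; exact (secUl 1).1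
    | succ n ih => exact step _ _ _ _ (secUl n).1 ih (secUl (n + 1)).2 (subUl n) (superUl (n + 1))
  have hle : ∀ n, MeshLE M (Ul n) (Ub n) := by
    intro n
    induction n with
    | zero => rw [hUl0', hUb0']; exact hord
    | succ n ih => exact step _ _ _ _ (secUl n).1 ih (secUb n).2 (subUl n) (superUb n)
  have limUb : ∀ a i j, ∃ L, M.IsMeshPt i j →
      Filter.Tendsto (fun n => Ub n a i j) Filter.atTop (nhds L) := fun a i j =>
    ⟨⨅ n, Ub n a i j, fun h => tendsto_atTop_ciInf
      (antitone_nat_of_succ_le fun n => antiUb n a i j h)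
      ⟨Uhat a i j, by rintro _ ⟨n, rfl⟩; exact (secUb n).1 a i j h⟩⟩
  have limUl : ∀ a i j, ∃ L, M.IsMeshPt i j →
      Filter.Tendsto (fun n => Ul n a i j) Filter.atTop (nhds L) := fun a i j =>
    ⟨⨆ n, Ul n a i j, fun h => tendsto_atTop_ciSup
      (monotone_nat_of_le_succ fun n => monoUl n a i j h)
      ⟨Utilde a i j, by rintro _ ⟨n, rfl⟩; exact (secUl n).2 a i j h⟩⟩
  choose Ubar hUbar using limUb
  choose Ulow hUlow using limUl
  have solUb := solution_of_tendsto (fun a i j => (hf a i j).continuous) subUb superUb hUbar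
  have solUl := solution_of_tendsto (fun a i j => (hf a i j).continuous) subUl superUl hUlow
  refine ⟨fun n hn a i j h => ?_, Ubar, Ulow, hUbar, hUlow, solUb.1, solUb.2, solUl.1, solUl.2,
    fun a i j h => le_of_tendsto_of_tendsto' (hUlow a i j h) (hUbar a i j h)
      fun n => hle n a i j h, ?_⟩
  · obtain ⟨m, rfl⟩ := Nat.exists_eq_add_of_le' hn
    exact ⟨monoUl m a i j h, hle (m + 1) a i j h, antiUb m a i j h⟩
  · intro S hS hSbd hSsec
    have subS : IsSubstep M ε v c f g S S :=
      ⟨fun a i j h => sub_nonpos.1 (by rw [lineOp_sub_explicitPart]; exact (hS a i j h).le),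
        fun a i j h => (hSbd a i j h).le⟩
    have superS : IsSuperstep M ε v c f g S S :=
      ⟨fun a i j h => sub_nonneg.1 (by rw [lineOp_sub_explicitPart]; exact (hS a i j h).ge),
        fun a i j h => (hSbd a i j h).ge⟩
    have hbetween : ∀ n, MeshLE M (Ul n) S ∧ MeshLE M S (Ub n) := by
      intro n
      induction n with
      | zero =>
        rw [hUl0', hUb0']
        exact ⟨fun a i j h => (hSsec a i j h).1, fun a i j h => (hSsec a i j h).2⟩
      | succ n ih =>
        exact ⟨step _ _ _ _ (secUl n).1 ih.1 (fun a i j h => (hSsec a i j h).2) (subUl n) superS,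
          step _ _ _ _ (fun a i j h => (hSsec a i j h).1) ih.2 (secUb n).2 subS (superUb n)⟩
    exact fun a i j h => ⟨le_of_tendsto' (hUlow a i j h) fun n => (hbetween n).1 a i j h,
      ge_of_tendsto' (hUbar a i j h) fun n => (hbetween n).2 a i j h⟩
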